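/- Let 𝔛 = (X, {A_i}_{i=0}^n) and 𝔜 = (Y, {A'_j}_{j=0}^m) be Q-polynomial association schemes with primitive idempotents {E_i}_{i=0}^n and {E'_j}_{j=0}^m. Then the composition of 𝔛 and 𝔜, whose primitive idempotents are E_{j0} := I_X ⊗ E'_j for 1 ≤ j ≤ m and E_{0i} := E_i ⊗ E'_0 for 0 ≤ i ≤ n, is a bivariate Q-polynomial association scheme on the domain D* := {(j,0) : 1 ≤ j ≤ m} ∪ {(0,i) : 0 ≤ i ≤ n} ⊆ ℕ² with respect to the lexicographic order ≤_lex. -/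

import Mathlib

open scoped BigOperators
open Matrix

noncomputable section

/-- The all-ones matrix `J`. -/
def matJ (X : Type*) : Matrix X X ℂ := Matrix.of fun _ _ => 1

/-- A family of matrices `A : ι → Matrix X X ℂ` forms a commutative association scheme:
0-1 matrices summing to `J`, containing the identity, closed under transpose, whose
pairwise products are linear combinations of the family and commute. -/
structure IsAssocScheme {X ι : Type*} [Fintype X] [DecidableEq X] [Fintype ι]
    (A : ι → Matrix X X ℂ) : Prop where
  entries_zero_one : ∀ (i : ι) (x y : X), A i x y = 0 ∨ A i x y = 1
  sum_eq_J : ∑ i, A i = matJ X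
  exists_id : ∃ i₀, A i₀ = 1
  exists_transpose : ∀ i, ∃ i', (A i)ᵀ = A i'
  mul_eq_lin : ∀ i j, ∃ p : ι → ℂ, A i * A j = ∑ k, p k • A k
  mul_comm' : ∀ i j, A i * A j = A j * A i

/-- A monomial order on `ℕ^ℓ`: a total well-ordering compatible with addition. -/
structure MonOrder (ℓ : ℕ) where
  le : (Fin ℓ → ℕ) → (Fin ℓ → ℕ) → Prop
  le_refl : ∀ a, le a a
  le_trans : ∀ a b c, le a b → le b c → le a c
  le_antisymm : ∀ a b, le a b → le b a → a = b
  le_total : ∀ a b, le a b ∨ le b a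
  wf : WellFounded fun a b => le a b ∧ a ≠ b
  add_compat : ∀ a b c, le a b → le (a + c) (b + c)

/-- The `i`-th standard unit vector of `ℕ^ℓ`. -/
def epsV {ℓ : ℕ} (i : Fin ℓ) : Fin ℓ → ℕ := Pi.single i 1

/-- Conversion from `Fin ℓ → ℕ` to exponents of `MvPolynomial`. -/
def toExp {ℓ : ℕ} (α : Fin ℓ → ℕ) : Fin ℓ →₀ ℕ := Finsupp.equivFunOnFinite.symm α

/-- `α` is the multidegree of `f` with respect to the monomial order `mo`. -/
def IsMultideg {ℓ : ℕ} (mo : MonOrder ℓ) (f : MvPolynomial (Fin ℓ) ℂ) (α : Fin ℓ → ℕ) : Prop :=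
  MvPolynomial.coeff (toExp α) f ≠ 0 ∧ ∀ d ∈ f.support, mo.le (⇑d) α

/-- The ordered monomial `M 1 ^ α 1 * ⋯ * M ℓ ^ α ℓ`. -/
def mpow {X : Type*} [Fintype X] [DecidableEq X] {ℓ : ℕ}
    (M : Fin ℓ → Matrix X X ℂ) (α : Fin ℓ → ℕ) : Matrix X X ℂ :=
  ((List.finRange ℓ).map fun i => M i ^ α i).prod

/-- Evaluation of a multivariate polynomial at a family of matrices. -/
def matEval {X : Type*} [Fintype X] [DecidableEq X] {ℓ : ℕ}
    (f : MvPolynomial (Fin ℓ) ℂ) (M : Fin ℓ → Matrix X X ℂ) : Matrix X X ℂ :=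
  ∑ d ∈ f.support, MvPolynomial.coeff d f • mpow M (⇑d)

/-- `ℓ`-variate `P`-polynomial association scheme on the domain `D` with respect to the
monomial order `mo`, with adjacency matrices (relabeled) `A α` for `α ∈ D`. -/
structure IsMultiPPoly {X : Type*} [Fintype X] [DecidableEq X] {ℓ : ℕ}
    (D : Finset (Fin ℓ → ℕ)) (mo : MonOrder ℓ)
    (A : (Fin ℓ → ℕ) → Matrix X X ℂ) : Prop where
  scheme : IsAssocScheme fun α : {a // a ∈ D} => A α.1
  eps_mem : ∀ i : Fin ℓ, epsV i ∈ D
  lower_closed : ∀ α ∈ D, ∀ β : Fin ℓ → ℕ, (∀ i, β i ≤ α i) → β ∈ D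
  exists_poly : ∀ α ∈ D, ∃ v : MvPolynomial (Fin ℓ) ℂ,
    A α = matEval v (fun i => A (epsV i)) ∧ IsMultideg mo v α ∧
      ∀ d ∈ v.support, ⇑d ∈ D
  recur : ∀ i : Fin ℓ, ∀ α ∈ D, ∃ c : (Fin ℓ → ℕ) → ℂ,
    (A (epsV i) * mpow (fun j => A (epsV j)) α
        = ∑ β ∈ D, c β • mpow (fun j => A (epsV j)) β) ∧
      ∀ β ∈ D, c β ≠ 0 → mo.le β (α + epsV i)

/-- The Hadamard (entrywise) monomial `E 1 ^{∘ α 1} ∘ ⋯ ∘ E ℓ ^{∘ α ℓ}`. -/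
def hpow {X : Type*} {ℓ : ℕ} (E : Fin ℓ → Matrix X X ℂ) (α : Fin ℓ → ℕ) : Matrix X X ℂ :=
  Matrix.of fun x y => ∏ i, (E i x y) ^ α i

/-- Evaluation of a multivariate polynomial at a family of matrices under the
Hadamard product. -/
def hEval {X : Type*} {ℓ : ℕ}
    (f : MvPolynomial (Fin ℓ) ℂ) (E : Fin ℓ → Matrix X X ℂ) : Matrix X X ℂ :=
  ∑ d ∈ f.support, MvPolynomial.coeff d f • hpow E (⇑d)

/-- `E` is the family of primitive idempotents of the Bose–Mesner algebra spanned by `A`. -/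
structure IsPrimIdem {X ι κ : Type*} [Fintype X] [DecidableEq X] [Fintype ι] [Fintype κ]
    (A : ι → Matrix X X ℂ) (E : κ → Matrix X X ℂ) : Prop where
  idem : ∀ j, E j * E j = E j
  orth : ∀ j k, j ≠ k → E j * E k = 0
  sum_eq_one : ∑ j, E j = 1
  span_eq : Submodule.span ℂ (Set.range E) = Submodule.span ℂ (Set.range A)

/-- `ℓ`-variate `Q`-polynomial association scheme on the domain `D` with respect to the
monomial order `mo`; `A` are the adjacency matrices and `E α` for `α ∈ D` the (relabeled)
primitive idempotents. -/
structure IsMultiQPoly {X ι : Type*} [Fintype X] [DecidableEq X] [Fintype ι] {ℓ : ℕ}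
    (D : Finset (Fin ℓ → ℕ)) (mo : MonOrder ℓ)
    (A : ι → Matrix X X ℂ) (E : (Fin ℓ → ℕ) → Matrix X X ℂ) : Prop where
  scheme : IsAssocScheme A
  primIdem : IsPrimIdem A fun α : {a // a ∈ D} => E α.1
  eps_mem : ∀ i : Fin ℓ, epsV i ∈ D
  lower_closed : ∀ α ∈ D, ∀ β : Fin ℓ → ℕ, (∀ i, β i ≤ α i) → β ∈ D
  exists_poly : ∀ α ∈ D, ∃ v : MvPolynomial (Fin ℓ) ℂ,
    (Fintype.card X : ℂ) • E α
        = hEval v (fun i => (Fintype.card X : ℂ) • E (epsV i)) ∧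
      IsMultideg mo v α ∧ ∀ d ∈ v.support, ⇑d ∈ D
  recur : ∀ i : Fin ℓ, ∀ α ∈ D, ∃ c : (Fin ℓ → ℕ) → ℂ,
    (Matrix.hadamard (E (epsV i)) (hpow (fun j => E (epsV j)) α)
        = ∑ β ∈ D, c β • hpow (fun j => E (epsV j)) β) ∧
      ∀ β ∈ D, c β ≠ 0 → mo.le β (α + epsV i)

/-- The graded lexicographic order on `ℕ^ℓ`. -/
def grlexLe {ℓ : ℕ} (a b : Fin ℓ → ℕ) : Prop :=
  (∑ i, a i) < (∑ i, b i) ∨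
    ((∑ i, a i) = (∑ i, b i) ∧
      (a = b ∨ ∃ i, (∀ j, j < i → a j = b j) ∧ a i < b i))

/-- The lexicographic order on `ℕ^ℓ`. -/
def lexLe {ℓ : ℕ} (a b : Fin ℓ → ℕ) : Prop :=
  a = b ∨ ∃ i, (∀ j, j < i → a j = b j) ∧ a i < b i

/-- Evaluation of a univariate polynomial at a matrix under the Hadamard product. -/
def hEval1 {X : Type*} (v : Polynomial ℂ) (M : Matrix X X ℂ) : Matrix X X ℂ :=
  ∑ n ∈ v.support, v.coeff n • Matrix.of fun x y => (M x y) ^ n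

end

section Composition

variable {X Y : Type*} [Fintype X] [DecidableEq X] [Fintype Y] [DecidableEq Y]

/-- The adjacency matrices of the composition of two association schemes:
`A_{i0} = A_i ⊗ J_Y` for `i ≥ 1` and `A_{0j} = I_X ⊗ A'_j`. -/
def compA (A : ℕ → Matrix X X ℂ) (A' : ℕ → Matrix Y Y ℂ) :
    (Fin 2 → ℕ) → Matrix (X × Y) (X × Y) ℂ :=
  fun α => Matrix.of fun p q =>
    if α 0 = 0 then (if p.1 = q.1 then A' (α 1) p.2 q.2 else 0)
    else A (α 0) p.1 q.1

/-- The primitive idempotents of the composition of two association schemes: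
`E_{j0} = I_X ⊗ E'_j` for `j ≥ 1` and `E_{0i} = E_i ⊗ E'_0`. -/
def compE (E : ℕ → Matrix X X ℂ) (E' : ℕ → Matrix Y Y ℂ) :
    (Fin 2 → ℕ) → Matrix (X × Y) (X × Y) ℂ :=
  fun α => Matrix.of fun p q =>
    if α 0 = 0 then E (α 1) p.1 q.1 * E' 0 p.2 q.2
    else (if p.1 = q.1 then (1 : ℂ) else 0) * E' (α 0) p.2 q.2

/-- The domain `D = {(i,0) : 1 ≤ i ≤ n} ∪ {(0,j) : 0 ≤ j ≤ m}` of the composition. -/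
def compD (n m : ℕ) : Finset (Fin 2 → ℕ) :=
  ((Finset.Icc 1 n).image fun i => (![i, 0] : Fin 2 → ℕ)) ∪
    ((Finset.range (m + 1)).image fun j => (![0, j] : Fin 2 → ℕ))

end Composition

open scoped Kronecker

/-- The Hadamard powers `M^{∘k}` of a matrix. -/
def hadamardPow {X : Type*} (M : Matrix X X ℂ) (k : ℕ) : Matrix X X ℂ :=
  M.map (· ^ k)

section Lex

theorem lexLe_fin_two {a b : Fin 2 → ℕ} :
    lexLe a b ↔ a 0 < b 0 ∨ a 0 = b 0 ∧ a 1 ≤ b 1 := by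
  simp only [lexLe, funext_iff, Fin.forall_fin_two, Fin.exists_fin_two]
  simp
  omega

theorem forall_mem_compD {n m : ℕ} {p : (Fin 2 → ℕ) → Prop} :
    (∀ α ∈ compD n m, p α) ↔
      (∀ i, 1 ≤ i → i ≤ n → p ![i, 0]) ∧ ∀ j ≤ m, p ![0, j] := by
  simp only [compD, Finset.mem_union, Finset.mem_image, Finset.mem_Icc, Finset.mem_range]
  constructor
  · exact fun h => ⟨fun i h1 h2 => h _ (.inl ⟨i, ⟨h1, h2⟩, rfl⟩),
      fun j hj => h _ (.inr ⟨j, by omega, rfl⟩)⟩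
  · rintro ⟨h1, h2⟩ _ (⟨i, ⟨hi, hi'⟩, rfl⟩ | ⟨j, hj, rfl⟩)
    exacts [h1 i hi hi', h2 j (by omega)]

theorem left_mem_compD {n m i : ℕ} (h1 : 1 ≤ i) (h2 : i ≤ n) : ![i, 0] ∈ compD n m :=
  (forall_mem_compD.1 fun _ h => h).1 i h1 h2

theorem right_mem_compD {n m j : ℕ} (h : j ≤ m) : ![0, j] ∈ compD n m :=
  (forall_mem_compD.1 fun _ h => h).2 j h

theorem mem_compD {n m : ℕ} {α : Fin 2 → ℕ} :
    α ∈ compD n m ↔ α 0 ≤ n ∧ α 1 ≤ m ∧ (α 0 = 0 ∨ α 1 = 0) := by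
  constructor
  · revert α
    rw [forall_mem_compD]
    simp +contextual
  · rintro ⟨h0, h1, h⟩
    obtain ⟨i, j, rfl⟩ : ∃ i j, α = ![i, j] := ⟨α 0, α 1, by ext i; fin_cases i <;> rfl⟩
    simp only [Matrix.cons_val_zero, Matrix.cons_val_one] at h h0 h1
    rcases Nat.eq_zero_or_pos i with rfl | hi
    · exact right_mem_compD h1
    · obtain rfl : j = 0 := by omega
      exact left_mem_compD hi h0

theorem sum_compD {M : Type*} [AddCommMonoid M] (n m : ℕ) (f : (Fin 2 → ℕ) → M) :
    ∑ α ∈ compD n m, f α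
      = ∑ i ∈ Finset.Icc 1 n, f ![i, 0] + ∑ j ∈ Finset.range (m + 1), f ![0, j] := by
  rw [compD, Finset.sum_union, Finset.sum_image, Finset.sum_image]
  · intro a _ b _ h
    simpa using congrFun h 1
  · intro a _ b _ h
    simpa using congrFun h 0
  · simp only [Finset.disjoint_left, Finset.mem_image, Finset.mem_Icc, not_exists, not_and]
    rintro _ ⟨i, hi, rfl⟩ j _ h
    have := congrFun h 0
    simp at this
    omega

theorem sum_Icc_one_add {M : Type*} [AddCommMonoid M] (n : ℕ) (f : ℕ → M) :
    ∑ i ∈ Finset.Icc 1 n, f i + f 0 = ∑ i : Fin (n + 1), f i := by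
  rw [Fin.sum_univ_eq_sum_range, Finset.sum_range_succ', Finset.range_eq_Ico,
    Finset.sum_Ico_add' f 0 n 1]
  rfl

end Lex

section Polynomials

theorem exists_sum_of_mem_span_hpow {X : Type*} {ℓ : ℕ} {D : Finset (Fin ℓ → ℕ)}
    {P : (Fin ℓ → ℕ) → Prop} {F : Fin ℓ → Matrix X X ℂ} {M : Matrix X X ℂ}
    (h : M ∈ Submodule.span ℂ (hpow F '' {β | β ∈ D ∧ P β})) :
    ∃ c : (Fin ℓ → ℕ) → ℂ, M = ∑ β ∈ D, c β • hpow F β ∧ ∀ β, c β ≠ 0 → β ∈ D ∧ P β := by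
  classical
  have hs : {β | β ∈ D ∧ P β} = ↑(D.filter P) := by ext; simp
  rw [hs, Submodule.mem_span_image_finset_iff_exists_fun] at h
  obtain ⟨c, rfl⟩ := h
  refine ⟨fun β => if h : β ∈ D.filter P then c ⟨β, h⟩ else 0, ?_, fun β hβ => ?_⟩
  · rw [← Finset.sum_subset (Finset.filter_subset P D)]
    · rw [← Finset.sum_coe_sort (D.filter P)]
      exact Finset.sum_congr rfl fun β _ => by simp only [dif_pos β.2]
    · intro β _ hβ
      simp only [dif_neg hβ, zero_smul]
  · by_contra hn
    exact hβ (dif_neg (by simpa using hn))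

theorem hEval_apply {X : Type*} {ℓ : ℕ} (f : MvPolynomial (Fin ℓ) ℂ)
    (F : Fin ℓ → Matrix X X ℂ) (x y : X) :
    hEval f F x y = MvPolynomial.eval (fun i => F i x y) f := by
  simp [hEval, hpow, MvPolynomial.eval_eq', Matrix.sum_apply]

theorem hpow_smul {X : Type*} {ℓ : ℕ} (N : ℂ) (F : Fin ℓ → Matrix X X ℂ) (β : Fin ℓ → ℕ) :
    hpow (fun i => N • F i) β = N ^ (∑ i, β i) • hpow F β := by
  ext x y
  simp [hpow, mul_pow, Finset.prod_mul_distrib, Finset.prod_pow_eq_pow_sum]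

/-- A matrix equal to a nonzero multiple of the Hadamard monomial of exponent `α` plus smaller
monomials is, after rescaling, a polynomial of multidegree `α`. -/
theorem exists_isMultideg {X : Type*} {ℓ : ℕ} {D : Finset (Fin ℓ → ℕ)} {mo : MonOrder ℓ}
    {F : Fin ℓ → Matrix X X ℂ} {M R : Matrix X X ℂ} {α : Fin ℓ → ℕ} {a N : ℂ} (hN : N ≠ 0)
    (hα : α ∈ D) (ha : a ≠ 0)
    (hR : R ∈ Submodule.span ℂ (hpow F '' {β | β ∈ D ∧ mo.le β α ∧ β ≠ α}))
    (hM : M = a • hpow F α + R) :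
    ∃ v : MvPolynomial (Fin ℓ) ℂ, N • M = hEval v (fun i => N • F i) ∧
      IsMultideg mo v α ∧ ∀ d ∈ v.support, ⇑d ∈ D := by
  classical
  obtain ⟨c, rfl, hc⟩ := exists_sum_of_mem_span_hpow hR
  have hcα : c α = 0 := by
    by_contra h
    exact (hc α h).2.2 rfl
  let c' : (Fin ℓ → ℕ) → ℂ := fun β => N * (N ^ (∑ i, β i))⁻¹ * (Pi.single (M := fun _ => ℂ) α a β + c β)
  let v : MvPolynomial (Fin ℓ) ℂ := ∑ β ∈ D, MvPolynomial.monomial (toExp β) (c' β)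
  have hcoeff (d : Fin ℓ →₀ ℕ) : v.coeff d = if ⇑d ∈ D then c' d else 0 := by
    have (β : Fin ℓ → ℕ) : toExp β = d ↔ β = ⇑d := by
      rw [toExp, Equiv.symm_apply_eq]
      rfl
    simp only [v, MvPolynomial.coeff_sum, MvPolynomial.coeff_monomial, this]
    rw [Finset.sum_ite_eq']
  have hsupp (d) (hd : d ∈ v.support) : ⇑d ∈ D ∧ c' d ≠ 0 := by
    rw [MvPolynomial.mem_support_iff, hcoeff] at hd
    exact ⟨by_contra fun h => hd (if_neg h), fun h => hd (by simp [h])⟩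
  refine ⟨v, ?_, ⟨?_, fun d hd => ?_⟩, fun d hd => (hsupp d hd).1⟩
  · have hM' : M = ∑ β ∈ D, (Pi.single (M := fun _ => ℂ) α a β + c β) • hpow F β := by
      simp only [hM, add_smul, Finset.sum_add_distrib, Pi.single_apply, ite_smul, zero_smul,
        Finset.sum_ite_eq', if_pos hα]
    have h : N • M = ∑ β ∈ D, c' β • hpow (fun i => N • F i) β := by
      rw [hM', Finset.smul_sum]
      refine Finset.sum_congr rfl fun β _ => ?_
      rw [hpow_smul, smul_smul, smul_smul]
      congr 1
      have : N ^ (∑ i, β i) ≠ 0 := pow_ne_zero _ hN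
      simp only [c']
      field_simp
    rw [h]
    ext x y
    rw [hEval_apply]
    simp only [v, map_sum, MvPolynomial.eval_monomial, Matrix.sum_apply, Matrix.smul_apply,
      smul_eq_mul, hpow, Matrix.of_apply]
    refine Finset.sum_congr rfl fun β _ => ?_
    rw [Finsupp.prod_fintype _ _ (by simp)]
    rfl
  · have : (⇑(toExp α) : Fin ℓ → ℕ) = α := rfl
    rw [hcoeff, this, if_pos hα]
    simp [c', hcα, ha, hN]
  · have h := (hsupp d hd).2
    by_cases hd' : ⇑d = α
    · rw [hd']
      exact mo.le_refl α
    · refine (hc d fun h0 => h ?_).2.1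
      simp [c', h0, hd']

theorem hEval1_apply {X : Type*} (v : Polynomial ℂ) (M : Matrix X X ℂ) (x y : X) :
    hEval1 v M x y = v.eval (M x y) := by
  simp [hEval1, Polynomial.eval_eq_sum, Polynomial.sum, Matrix.sum_apply]

theorem exists_hadamardPow_add {X : Type*} {M B : Matrix X X ℂ} {v : Polynomial ℂ} {i : ℕ} {N : ℂ}
    (hN : N ≠ 0) (hv : v.degree = i) (h : N • M = hEval1 v (N • B)) :
    ∃ a : ℂ, a ≠ 0 ∧ ∃ R ∈ Submodule.span ℂ (hadamardPow B '' Set.Iio i),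
      M = a • hadamardPow B i + R := by
  have hnat := Polynomial.natDegree_eq_of_degree_eq_some hv
  refine ⟨N⁻¹ * v.coeff i * N ^ i, ?_,
    ∑ k ∈ Finset.range i, (N⁻¹ * v.coeff k * N ^ k) • hadamardPow B k, ?_, ?_⟩
  · have : v.coeff i ≠ 0 := Polynomial.coeff_ne_zero_of_eq_degree hv
    simp [hN, this]
  · exact Submodule.sum_mem _ fun k hk => Submodule.smul_mem _ _
      (Submodule.subset_span ⟨k, Finset.mem_range.1 hk, rfl⟩)
  · rw [add_comm, ← Finset.sum_range_succ
      (fun k => (N⁻¹ * v.coeff k * N ^ k) • hadamardPow B k) i, ← inv_smul_smul₀ hN M, h]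
    ext x y
    rw [Matrix.smul_apply, hEval1_apply, Polynomial.eval_eq_sum_range' (n := i + 1) (by omega)]
    simp only [Matrix.sum_apply, Matrix.smul_apply, smul_eq_mul, Finset.mul_sum, hadamardPow,
      Matrix.map_apply, mul_pow]
    exact Finset.sum_congr rfl fun k _ => by ring

end Polynomials

section Scheme

variable {X Y ι κ : Type*} [Fintype X] [DecidableEq X] [Fintype Y] [DecidableEq Y]
  [Fintype ι] [Fintype κ]

theorem IsAssocScheme.hadamard_eq {A : ι → Matrix X X ℂ} (hA : IsAssocScheme A) {i j : ι}
    (hij : i ≠ j) : A i ⊙ A j = 0 := by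
  classical
  ext x y
  by_contra h
  have hne : A i x y ≠ 0 ∧ A j x y ≠ 0 := by simpa [not_or] using h
  have hi := (hA.entries_zero_one i x y).resolve_left hne.1
  have hj := (hA.entries_zero_one j x y).resolve_left hne.2
  have hsum : ∑ k, A k x y = 1 := by
    simpa [Matrix.sum_apply, matJ] using congrFun (congrFun hA.sum_eq_J x) y
  have hre : ∑ k, (A k x y).re = 1 := by simpa using congrArg Complex.re hsum
  have hnonneg : ∀ k, 0 ≤ (A k x y).re := fun k => by
    rcases hA.entries_zero_one k x y with h | h <;> simp [h]
  have hle : ∑ k ∈ {i, j}, (A k x y).re ≤ ∑ k, (A k x y).re :=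
    Finset.sum_le_sum_of_subset_of_nonneg (Finset.subset_univ _) fun k _ _ => hnonneg k
  rw [Finset.sum_pair hij, hi, hj, hre] at hle
  norm_num at hle

theorem IsAssocScheme.hadamard_self {A : ι → Matrix X X ℂ} (hA : IsAssocScheme A) (i : ι) :
    A i ⊙ A i = A i := by
  ext x y
  rcases hA.entries_zero_one i x y with h | h <;> simp [h]

theorem IsAssocScheme.matJ_mem {A : ι → Matrix X X ℂ} (hA : IsAssocScheme A) :
    matJ X ∈ Submodule.span ℂ (Set.range A) := by
  rw [← hA.sum_eq_J]
  exact Submodule.sum_mem _ fun i _ => Submodule.subset_span ⟨i, rfl⟩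

/-- The Bose–Mesner algebra is closed under the Hadamard product. -/
theorem IsAssocScheme.hadamard_mem {A : ι → Matrix X X ℂ} (hA : IsAssocScheme A)
    {M N : Matrix X X ℂ} (hM : M ∈ Submodule.span ℂ (Set.range A))
    (hN : N ∈ Submodule.span ℂ (Set.range A)) :
    M ⊙ N ∈ Submodule.span ℂ (Set.range A) := by
  classical
  induction hM using Submodule.span_induction with
  | mem M hM =>
    obtain ⟨i, rfl⟩ := hM
    induction hN using Submodule.span_induction with
    | mem N hN =>
      obtain ⟨j, rfl⟩ := hN
      by_cases hij : i = j
      · rw [hij, hA.hadamard_self]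
        exact Submodule.subset_span ⟨j, rfl⟩
      · rw [hA.hadamard_eq hij]
        exact Submodule.zero_mem _
    | zero => simp
    | add M N _ _ h1 h2 => rw [Matrix.hadamard_add]; exact Submodule.add_mem _ h1 h2
    | smul a M _ h => rw [Matrix.hadamard_smul]; exact Submodule.smul_mem _ _ h
  | zero => simp
  | add M N _ _ h1 h2 => rw [Matrix.add_hadamard]; exact Submodule.add_mem _ h1 h2
  | smul a M _ h => rw [Matrix.smul_hadamard]; exact Submodule.smul_mem _ _ h

theorem IsAssocScheme.hadamardPow_mem {A : ι → Matrix X X ℂ} (hA : IsAssocScheme A)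
    {M : Matrix X X ℂ} (hM : M ∈ Submodule.span ℂ (Set.range A)) (k : ℕ) :
    hadamardPow M k ∈ Submodule.span ℂ (Set.range A) := by
  induction k with
  | zero =>
    convert hA.matJ_mem using 1
    ext x y
    simp [hadamardPow, matJ]
  | succ k ih =>
    convert hA.hadamard_mem ih hM using 1
    ext x y
    simp [hadamardPow, pow_succ]

/-- Elements of the Bose–Mesner algebra have constant diagonal. -/
theorem IsAssocScheme.exists_diag_eq {A : ι → Matrix X X ℂ} (hA : IsAssocScheme A)
    {M : Matrix X X ℂ} (hM : M ∈ Submodule.span ℂ (Set.range A)) :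
    ∃ d : ℂ, ∀ x, M x x = d := by
  classical
  obtain ⟨i₀, h0⟩ := hA.exists_id
  induction hM using Submodule.span_induction with
  | mem M hM =>
    obtain ⟨i, rfl⟩ := hM
    by_cases hi : i₀ = i
    · exact ⟨1, fun x => by simp [← hi, h0]⟩
    · refine ⟨0, fun x => ?_⟩
      simpa [h0] using congrFun (congrFun (hA.hadamard_eq hi) x) x
  | zero => exact ⟨0, by simp⟩
  | add M N _ _ h1 h2 =>
    obtain ⟨a, ha⟩ := h1
    obtain ⟨b, hb⟩ := h2
    exact ⟨a + b, fun x => by simp [ha, hb]⟩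
  | smul c M _ h =>
    obtain ⟨a, ha⟩ := h
    exact ⟨c * a, fun x => by simp [ha]⟩

theorem IsAssocScheme.mul_mem {A : ι → Matrix X X ℂ} (hA : IsAssocScheme A) (i j : ι) :
    A i * A j ∈ Submodule.span ℂ (Set.range A) := by
  obtain ⟨p, hp⟩ := hA.mul_eq_lin i j
  exact (Submodule.mem_span_range_iff_exists_fun ℂ).2 ⟨p, hp.symm⟩

theorem IsAssocScheme.matJ_mul_comm {A : ι → Matrix X X ℂ} (hA : IsAssocScheme A) (i : ι) :
    matJ X * A i = A i * matJ X := by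
  rw [← hA.sum_eq_J, Finset.sum_mul, Finset.mul_sum]
  exact Finset.sum_congr rfl fun j _ => hA.mul_comm' j i

theorem IsPrimIdem.exists_mul_eq_smul {A : ι → Matrix X X ℂ} {E : κ → Matrix X X ℂ}
    (hE : IsPrimIdem A E) (i : ι) (k : κ) : ∃ c : ℂ, E k * A i = c • E k := by
  classical
  have h : A i ∈ Submodule.span ℂ (Set.range E) := hE.span_eq ▸ Submodule.subset_span ⟨i, rfl⟩
  obtain ⟨c, hc⟩ := (Submodule.mem_span_range_iff_exists_fun ℂ).1 h
  refine ⟨c k, ?_⟩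
  rw [← hc, Finset.mul_sum, Finset.sum_eq_single k]
  · rw [Matrix.mul_smul, hE.idem]
  · intro j _ hj
    rw [Matrix.mul_smul, hE.orth k j hj.symm, smul_zero]
  · simp

omit [DecidableEq X] in
theorem matJ_eq_card_smul :
    matJ X = (Fintype.card X : ℂ) • ((Fintype.card X : ℂ)⁻¹ • matJ X) := by
  ext x y
  have : Nonempty X := ⟨x⟩
  simp [matJ]

omit [DecidableEq X] in
theorem matJ_mul_matJ : matJ X * matJ X = (Fintype.card X : ℂ) • matJ X := by
  ext x y
  simp [matJ, Matrix.mul_apply]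

end Scheme

section CompositionMatrices

variable {X Y : Type*} [DecidableEq X]

theorem compA_left (A : ℕ → Matrix X X ℂ) (A' : ℕ → Matrix Y Y ℂ) {i : ℕ} (hi : 1 ≤ i) :
    compA A A' ![i, 0] = A i ⊗ₖ matJ Y := by
  ext p q
  simp [compA, matJ, show i ≠ 0 by omega]

theorem compA_right (A : ℕ → Matrix X X ℂ) (A' : ℕ → Matrix Y Y ℂ) (j : ℕ) :
    compA A A' ![0, j] = (1 : Matrix X X ℂ) ⊗ₖ A' j := by
  ext p q
  simp [compA, Matrix.one_apply]

theorem compE_left (E : ℕ → Matrix X X ℂ) (E' : ℕ → Matrix Y Y ℂ) {j : ℕ} (hj : 1 ≤ j) :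
    compE E E' ![j, 0] = (1 : Matrix X X ℂ) ⊗ₖ E' j := by
  ext p q
  simp [compE, Matrix.one_apply, show j ≠ 0 by omega]

theorem compE_right (E : ℕ → Matrix X X ℂ) (E' : ℕ → Matrix Y Y ℂ) (i : ℕ) :
    compE E E' ![0, i] = E i ⊗ₖ E' 0 := by
  ext p q
  simp [compE]

/-- The linear map `M ↦ M ⊗ N`. -/
abbrev kroneckerRight (N : Matrix Y Y ℂ) :
    Matrix X X ℂ →ₗ[ℂ] Matrix (X × Y) (X × Y) ℂ :=
  (Matrix.kroneckerBilinear (R := ℂ)).flip N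

/-- The linear map `N ↦ M ⊗ N`. -/
abbrev kroneckerLeft (M : Matrix X X ℂ) :
    Matrix Y Y ℂ →ₗ[ℂ] Matrix (X × Y) (X × Y) ℂ :=
  Matrix.kroneckerBilinear (R := ℂ) M

/-- The span of the matrices `M ⊗ J` and `I ⊗ N` for `M ∈ S` and `N ∈ T`. -/
def compSpan (S : Submodule ℂ (Matrix X X ℂ)) (T : Submodule ℂ (Matrix Y Y ℂ)) :
    Submodule ℂ (Matrix (X × Y) (X × Y) ℂ) :=
  S.map (kroneckerRight (matJ Y)) ⊔ T.map (kroneckerLeft 1)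

theorem kronecker_matJ_mem_compSpan {S : Submodule ℂ (Matrix X X ℂ)}
    {T : Submodule ℂ (Matrix Y Y ℂ)} {M : Matrix X X ℂ} (hM : M ∈ S) :
    M ⊗ₖ matJ Y ∈ compSpan S T :=
  Submodule.mem_sup_left ⟨M, hM, rfl⟩

theorem one_kronecker_mem_compSpan {S : Submodule ℂ (Matrix X X ℂ)}
    {T : Submodule ℂ (Matrix Y Y ℂ)} {N : Matrix Y Y ℂ} (hN : N ∈ T) :
    (1 : Matrix X X ℂ) ⊗ₖ N ∈ compSpan S T :=
  Submodule.mem_sup_right ⟨N, hN, rfl⟩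

omit [DecidableEq X] in
theorem kronecker_mem_of_mem_span {s : Set (Matrix X X ℂ)} {N : Matrix Y Y ℂ}
    {U : Submodule ℂ (Matrix (X × Y) (X × Y) ℂ)} {M : Matrix X X ℂ}
    (hM : M ∈ Submodule.span ℂ s) (h : ∀ M ∈ s, M ⊗ₖ N ∈ U) : M ⊗ₖ N ∈ U :=
  (Submodule.span_le (p := U.comap (kroneckerRight N))).2 h hM

theorem one_kronecker_mem_of_mem_span {t : Set (Matrix Y Y ℂ)}
    {U : Submodule ℂ (Matrix (X × Y) (X × Y) ℂ)} {N : Matrix Y Y ℂ}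
    (hN : N ∈ Submodule.span ℂ t) (h : ∀ N ∈ t, (1 : Matrix X X ℂ) ⊗ₖ N ∈ U) :
    (1 : Matrix X X ℂ) ⊗ₖ N ∈ U :=
  (Submodule.span_le (p := U.comap (kroneckerLeft 1))).2 h hN

theorem compSpan_span_le {s : Set (Matrix X X ℂ)} {t : Set (Matrix Y Y ℂ)}
    {U : Submodule ℂ (Matrix (X × Y) (X × Y) ℂ)} (hs : ∀ M ∈ s, M ⊗ₖ matJ Y ∈ U)
    (ht : ∀ N ∈ t, (1 : Matrix X X ℂ) ⊗ₖ N ∈ U) :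
    compSpan (Submodule.span ℂ s) (Submodule.span ℂ t) ≤ U :=
  sup_le (Submodule.map_le_iff_le_comap.2 (Submodule.span_le.2 hs))
    (Submodule.map_le_iff_le_comap.2 (Submodule.span_le.2 ht))

end CompositionMatrices

section Composition

variable {X Y : Type*} [Fintype X] [DecidableEq X] [Fintype Y] [DecidableEq Y]

omit [Fintype X] in
theorem span_compA {n m : ℕ} {A : ℕ → Matrix X X ℂ} {A' : ℕ → Matrix Y Y ℂ}
    (hY : IsAssocScheme fun j : Fin (m + 1) => A' j) (hA0 : A 0 = 1) :
    Submodule.span ℂ (Set.range fun a : {x // x ∈ compD n m} => compA A A' a.1)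
      = compSpan (Submodule.span ℂ (Set.range fun i : Fin (n + 1) => A i))
          (Submodule.span ℂ (Set.range fun j : Fin (m + 1) => A' j)) := by
  have hright (N) (hN : N ∈ Submodule.span ℂ (Set.range fun j : Fin (m + 1) => A' j)) :
      (1 : Matrix X X ℂ) ⊗ₖ N ∈ Submodule.span ℂ
        (Set.range fun a : {x // x ∈ compD n m} => compA A A' a.1) := by
    refine one_kronecker_mem_of_mem_span hN ?_
    rintro _ ⟨j, rfl⟩
    exact Submodule.subset_span ⟨⟨_, right_mem_compD (Nat.lt_succ_iff.1 j.2)⟩, compA_right A A' j⟩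
  apply le_antisymm
  · rw [Submodule.span_le]
    suffices h : ∀ α ∈ compD n m, compA A A' α ∈ compSpan
        (Submodule.span ℂ (Set.range fun i : Fin (n + 1) => A i))
        (Submodule.span ℂ (Set.range fun j : Fin (m + 1) => A' j)) by
      rintro _ ⟨a, rfl⟩
      exact h a a.2
    rw [forall_mem_compD]
    refine ⟨fun i h1 hi => ?_, fun j hj => ?_⟩
    · simp only [compA_left A A' h1]
      exact kronecker_matJ_mem_compSpan
        (Submodule.subset_span ⟨⟨i, Nat.lt_succ_iff.2 hi⟩, rfl⟩)
    · simp only [compA_right]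
      exact one_kronecker_mem_compSpan
        (Submodule.subset_span ⟨⟨j, Nat.lt_succ_iff.2 hj⟩, rfl⟩)
  · refine compSpan_span_le ?_ fun N hN => hright N (Submodule.subset_span hN)
    rintro _ ⟨i, rfl⟩
    rcases Nat.eq_zero_or_pos (i : ℕ) with hi | hi
    · simp only [hi, hA0]
      exact hright _ hY.matJ_mem
    · exact Submodule.subset_span
        ⟨⟨_, left_mem_compD hi (Nat.lt_succ_iff.1 i.2)⟩, compA_left A A' hi⟩

theorem IsAssocScheme.comp {n m : ℕ} {A : ℕ → Matrix X X ℂ} {A' E' : ℕ → Matrix Y Y ℂ}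
    (hX : IsAssocScheme fun i : Fin (n + 1) => A i)
    (hY : IsAssocScheme fun j : Fin (m + 1) => A' j)
    (hA0 : A 0 = 1) (hA'0 : A' 0 = 1)
    (hXsym : ∀ i ≤ n, (A i)ᵀ = A i) (hYsym : ∀ j ≤ m, (A' j)ᵀ = A' j)
    (hYprim : IsPrimIdem (fun j : Fin (m + 1) => A' j) (fun j : Fin (m + 1) => E' j))
    (hE'0 : E' 0 = (Fintype.card Y : ℂ)⁻¹ • matJ Y) :
    IsAssocScheme fun a : {x // x ∈ compD n m} => compA A A' a.1 := by
  have hJ (j) (hj : j ≤ m) : ∃ c : ℂ, matJ Y * A' j = c • matJ Y := by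
    obtain ⟨c, hc⟩ := hYprim.exists_mul_eq_smul ⟨j, Nat.lt_succ_iff.2 hj⟩ 0
    refine ⟨c, ?_⟩
    rw [matJ_eq_card_smul, ← hE'0, Matrix.smul_mul, smul_comm c]
    exact congrArg _ hc
  have hJ' (j) (hj : j ≤ m) : matJ Y * A' j = A' j * matJ Y :=
    hY.matJ_mul_comm ⟨j, Nat.lt_succ_iff.2 hj⟩
  have hcomm : ∀ α ∈ compD n m, ∀ β ∈ compD n m,
      compA A A' α * compA A A' β = compA A A' β * compA A A' α := by
    simp only [forall_mem_compD]
    refine ⟨fun i h1 hi => ⟨fun k h1' hk => ?_, fun k hk => ?_⟩,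
      fun j hj => ⟨fun k h1' hk => ?_, fun k hk => ?_⟩⟩
    · simp only [compA_left A A' h1, compA_left A A' h1', ← Matrix.mul_kronecker_mul]
      rw [hX.mul_comm' ⟨i, Nat.lt_succ_iff.2 hi⟩ ⟨k, Nat.lt_succ_iff.2 hk⟩]
    · simp only [compA_left A A' h1, compA_right, ← Matrix.mul_kronecker_mul, hJ' k hk, one_mul,
        mul_one]
    · simp only [compA_left A A' h1', compA_right, ← Matrix.mul_kronecker_mul, hJ' j hj, one_mul,
        mul_one]
    · simp only [compA_right, ← Matrix.mul_kronecker_mul]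
      rw [hY.mul_comm' ⟨j, Nat.lt_succ_iff.2 hj⟩ ⟨k, Nat.lt_succ_iff.2 hk⟩]
  have hleft (i) (h1 : 1 ≤ i) (hi : i ≤ n) (k) (hk : k ≤ m) :
      compA A A' ![i, 0] * compA A A' ![0, k] ∈
        compSpan (Submodule.span ℂ (Set.range fun i : Fin (n + 1) => A i))
          (Submodule.span ℂ (Set.range fun j : Fin (m + 1) => A' j)) := by
    obtain ⟨c, hc⟩ := hJ k hk
    rw [compA_left A A' h1, compA_right, ← Matrix.mul_kronecker_mul, hc, mul_one,
      Matrix.kronecker_smul]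
    exact Submodule.smul_mem _ _ (kronecker_matJ_mem_compSpan
      (Submodule.subset_span ⟨⟨i, Nat.lt_succ_iff.2 hi⟩, rfl⟩))
  have hmul : ∀ α ∈ compD n m, ∀ β ∈ compD n m, compA A A' α * compA A A' β ∈
      compSpan (Submodule.span ℂ (Set.range fun i : Fin (n + 1) => A i))
          (Submodule.span ℂ (Set.range fun j : Fin (m + 1) => A' j)) := by
    simp only [forall_mem_compD]
    refine ⟨fun i h1 hi => ⟨fun k h1' hk => ?_, hleft i h1 hi⟩,
      fun j hj => ⟨fun k h1' hk => ?_, fun k hk => ?_⟩⟩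
    · rw [compA_left A A' h1, compA_left A A' h1', ← Matrix.mul_kronecker_mul, matJ_mul_matJ,
        Matrix.kronecker_smul]
      exact Submodule.smul_mem _ _ (kronecker_matJ_mem_compSpan
        (hX.mul_mem ⟨i, Nat.lt_succ_iff.2 hi⟩ ⟨k, Nat.lt_succ_iff.2 hk⟩))
    · rw [hcomm _ (right_mem_compD hj) _ (left_mem_compD h1' hk)]
      exact hleft k h1' hk j hj
    · rw [compA_right, compA_right, ← Matrix.mul_kronecker_mul, one_mul]
      exact one_kronecker_mem_compSpan
        (hY.mul_mem ⟨j, Nat.lt_succ_iff.2 hj⟩ ⟨k, Nat.lt_succ_iff.2 hk⟩)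
  refine ⟨?_, ?_, ?_, ?_, ?_, fun a b => hcomm a a.2 b b.2⟩
  · suffices h : ∀ α ∈ compD n m, ∀ p q, compA A A' α p q = 0 ∨ compA A A' α p q = 1 from
      fun a => h a a.2
    rw [forall_mem_compD]
    refine ⟨fun i h1 hi p q => ?_, fun j hj p q => ?_⟩
    · simpa [compA_left A A' h1, matJ] using
        hX.entries_zero_one ⟨i, Nat.lt_succ_iff.2 hi⟩ p.1 q.1
    · by_cases hpq : p.1 = q.1
      · simpa [compA, hpq] using hY.entries_zero_one ⟨j, Nat.lt_succ_iff.2 hj⟩ p.2 q.2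
      · simp [compA, hpq]
  · rw [Finset.sum_coe_sort (compD n m) (compA A A'), sum_compD,
      Finset.sum_congr rfl fun i hi => compA_left A A' (Finset.mem_Icc.1 hi).1,
      Finset.sum_congr rfl fun j _ => compA_right A A' j, Finset.sum_range]
    have h1 := (map_sum (kroneckerLeft (Y := Y) (1 : Matrix X X ℂ))
      (fun j : Fin (m + 1) => A' j) Finset.univ).symm
    rw [hY.sum_eq_J, ← hA0] at h1
    simp only [hA0] at h1
    have h2 := sum_Icc_one_add n fun i => A i ⊗ₖ matJ Y
    have h3 := (map_sum (kroneckerRight (X := X) (matJ Y))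
      (fun i : Fin (n + 1) => A i) Finset.univ).symm
    rw [hX.sum_eq_J] at h3
    simp only [hA0] at h2
    refine (congrArg _ h1).trans (h2.trans (h3.trans ?_))
    ext p q
    simp [matJ, Matrix.kroneckerBilinear]
  · refine ⟨⟨_, right_mem_compD (Nat.zero_le m)⟩, ?_⟩
    simp only [compA_right, hA'0, Matrix.one_kronecker_one]
  · suffices h : ∀ α ∈ compD n m, (compA A A' α)ᵀ = compA A A' α from fun a => ⟨a, h a a.2⟩
    rw [forall_mem_compD]
    refine ⟨fun i h1 hi => ?_, fun j hj => ?_⟩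
    · simp only [compA_left A A' h1, ← Matrix.kroneckerMap_transpose, hXsym i hi]
      rfl
    · simp only [compA_right, ← Matrix.kroneckerMap_transpose, hYsym j hj, Matrix.transpose_one]
  · intro a b
    have := hmul a a.2 b b.2
    rw [← span_compA hY hA0] at this
    obtain ⟨c, hc⟩ := (Submodule.mem_span_range_iff_exists_fun ℂ).1 this
    exact ⟨c, hc.symm⟩

theorem span_compE {n m : ℕ} {A E : ℕ → Matrix X X ℂ} {A' E' : ℕ → Matrix Y Y ℂ}
    (hXprim : IsPrimIdem (fun i : Fin (n + 1) => A i) (fun i : Fin (n + 1) => E i))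
    (hYprim : IsPrimIdem (fun j : Fin (m + 1) => A' j) (fun j : Fin (m + 1) => E' j))
    (hE'0 : E' 0 = (Fintype.card Y : ℂ)⁻¹ • matJ Y) :
    Submodule.span ℂ (Set.range fun a : {x // x ∈ compD m n} => compE E E' a.1)
      = compSpan (Submodule.span ℂ (Set.range fun i : Fin (n + 1) => A i))
          (Submodule.span ℂ (Set.range fun j : Fin (m + 1) => A' j)) := by
  rw [← hXprim.span_eq, ← hYprim.span_eq]
  have hE (i : Fin (n + 1)) : E i ⊗ₖ E' 0 ∈ Submodule.span ℂ
      (Set.range fun a : {x // x ∈ compD m n} => compE E E' a.1) :=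
    Submodule.subset_span ⟨⟨_, right_mem_compD (Nat.lt_succ_iff.1 i.2)⟩, compE_right E E' i⟩
  apply le_antisymm
  · rw [Submodule.span_le]
    suffices h : ∀ α ∈ compD m n, compE E E' α ∈ compSpan
        (Submodule.span ℂ (Set.range fun i : Fin (n + 1) => E i))
        (Submodule.span ℂ (Set.range fun j : Fin (m + 1) => E' j)) by
      rintro _ ⟨a, rfl⟩
      exact h a a.2
    rw [forall_mem_compD]
    refine ⟨fun j h1 hj => ?_, fun i hi => ?_⟩
    · rw [compE_left E E' h1]
      exact one_kronecker_mem_compSpan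
        (Submodule.subset_span ⟨⟨j, Nat.lt_succ_iff.2 hj⟩, rfl⟩)
    · rw [compE_right, hE'0, Matrix.kronecker_smul]
      exact Submodule.smul_mem _ _ (kronecker_matJ_mem_compSpan
        (Submodule.subset_span ⟨⟨i, Nat.lt_succ_iff.2 hi⟩, rfl⟩))
  · refine compSpan_span_le ?_ ?_
    · rintro _ ⟨i, rfl⟩
      rw [matJ_eq_card_smul, ← hE'0, Matrix.kronecker_smul]
      exact Submodule.smul_mem _ _ (hE i)
    · rintro _ ⟨j, rfl⟩
      rcases Nat.eq_zero_or_pos (j : ℕ) with hj | hj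
      · have h1 : (1 : Matrix X X ℂ) ∈ Submodule.span ℂ
            (Set.range fun i : Fin (n + 1) => E i) := by
          rw [← hXprim.sum_eq_one]
          exact Submodule.sum_mem _ fun i _ => Submodule.subset_span ⟨i, rfl⟩
        simp only [hj]
        refine kronecker_mem_of_mem_span h1 ?_
        rintro _ ⟨i, rfl⟩
        exact hE i
      · exact Submodule.subset_span
          ⟨⟨_, left_mem_compD hj (Nat.lt_succ_iff.1 j.2)⟩, compE_left E E' hj⟩

theorem IsPrimIdem.comp {n m : ℕ} {A E : ℕ → Matrix X X ℂ} {A' E' : ℕ → Matrix Y Y ℂ}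
    (hXprim : IsPrimIdem (fun i : Fin (n + 1) => A i) (fun i : Fin (n + 1) => E i))
    (hYprim : IsPrimIdem (fun j : Fin (m + 1) => A' j) (fun j : Fin (m + 1) => E' j))
    (hYscheme : IsAssocScheme fun j : Fin (m + 1) => A' j) (hA0 : A 0 = 1)
    (hE'0 : E' 0 = (Fintype.card Y : ℂ)⁻¹ • matJ Y) :
    IsPrimIdem (fun a : {x // x ∈ compD n m} => compA A A' a.1)
      (fun α : {a // a ∈ compD m n} => compE E E' α.1) := by
  have hXorth (i k) (hi : i ≤ n) (hk : k ≤ n) (h : i ≠ k) : E i * E k = 0 :=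
    hXprim.orth ⟨i, Nat.lt_succ_iff.2 hi⟩ ⟨k, Nat.lt_succ_iff.2 hk⟩ (by simpa using h)
  have hYorth (i k) (hi : i ≤ m) (hk : k ≤ m) (h : i ≠ k) : E' i * E' k = 0 :=
    hYprim.orth ⟨i, Nat.lt_succ_iff.2 hi⟩ ⟨k, Nat.lt_succ_iff.2 hk⟩ (by simpa using h)
  have hYidem (j) (hj : j ≤ m) : E' j * E' j = E' j := hYprim.idem ⟨j, Nat.lt_succ_iff.2 hj⟩
  have hXidem (i) (hi : i ≤ n) : E i * E i = E i := hXprim.idem ⟨i, Nat.lt_succ_iff.2 hi⟩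
  refine ⟨?_, ?_, ?_, ?_⟩
  · suffices h : ∀ α ∈ compD m n, compE E E' α * compE E E' α = compE E E' α from
      fun a => h a a.2
    rw [forall_mem_compD]
    refine ⟨fun j h1 hj => ?_, fun i hi => ?_⟩
    · rw [compE_left E E' h1, ← Matrix.mul_kronecker_mul, one_mul, hYidem j hj]
    · rw [compE_right, ← Matrix.mul_kronecker_mul, hXidem i hi, hYidem 0 (Nat.zero_le m)]
  · suffices h : ∀ α ∈ compD m n, ∀ β ∈ compD m n, α ≠ β → compE E E' α * compE E E' β = 0 from
      fun a b hab => h a a.2 b b.2 fun h => hab (Subtype.ext h)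
    simp only [forall_mem_compD]
    refine ⟨fun j h1 hj => ⟨fun k h1' hk h => ?_, fun k hk _ => ?_⟩,
      fun i hi => ⟨fun k h1' hk _ => ?_, fun k hk h => ?_⟩⟩
    · rw [compE_left E E' h1, compE_left E E' h1', ← Matrix.mul_kronecker_mul,
        hYorth j k hj hk (by rintro rfl; exact h rfl), Matrix.kronecker_zero]
    · rw [compE_left E E' h1, compE_right, ← Matrix.mul_kronecker_mul,
        hYorth j 0 hj (Nat.zero_le m) (by omega), Matrix.kronecker_zero]
    · rw [compE_left E E' h1', compE_right, ← Matrix.mul_kronecker_mul,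
        hYorth 0 k (Nat.zero_le m) hk (by omega), Matrix.kronecker_zero]
    · rw [compE_right, compE_right, ← Matrix.mul_kronecker_mul,
        hXorth i k hi hk (by rintro rfl; exact h rfl), Matrix.zero_kronecker]
  · rw [Finset.sum_coe_sort (compD m n) (compE E E'), sum_compD,
      Finset.sum_congr rfl fun j hj => compE_left E E' (Finset.mem_Icc.1 hj).1,
      Finset.sum_congr rfl fun i _ => compE_right E E' i, Finset.sum_range]
    have h1 := (map_sum (kroneckerRight (E' 0))
      (fun i : Fin (n + 1) => E i) Finset.univ).symm
    rw [hXprim.sum_eq_one] at h1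
    have h2 := sum_Icc_one_add m fun j => (1 : Matrix X X ℂ) ⊗ₖ E' j
    have h3 := (map_sum (kroneckerLeft (1 : Matrix X X ℂ))
      (fun j : Fin (m + 1) => E' j) Finset.univ).symm
    rw [hYprim.sum_eq_one] at h3
    exact (congrArg _ h1).trans (h2.trans (h3.trans Matrix.one_kronecker_one))
  · rw [span_compE hXprim hYprim hE'0, span_compA hYscheme hA0]

end Composition

section HadamardPowers

theorem hadamard_hpow {X : Type*} {ℓ : ℕ} (F : Fin ℓ → Matrix X X ℂ) (i : Fin ℓ)
    (α : Fin ℓ → ℕ) : F i ⊙ hpow F α = hpow F (α + epsV i) := by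
  ext x y
  simp only [hpow, epsV, Matrix.hadamard_apply, Matrix.of_apply, Pi.add_apply, pow_add,
    Finset.prod_mul_distrib]
  rw [mul_comm, Finset.prod_eq_single i (f := fun j => F j x y ^ (Pi.single i 1 : Fin ℓ → ℕ) j)]
  · simp
  · intro j _ hj
    simp [hj]
  · simp

theorem epsV_zero : (epsV 0 : Fin 2 → ℕ) = ![1, 0] := by
  ext i
  fin_cases i <;> rfl

theorem epsV_one : (epsV 1 : Fin 2 → ℕ) = ![0, 1] := by
  ext i
  fin_cases i <;> rfl

/-- In a `Q`-polynomial scheme the Bose–Mesner algebra is spanned by the Hadamard powers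
of `E 1` of exponent at most `n`. -/
theorem span_le_span_hadamardPow {X : Type*} [Fintype X] [DecidableEq X] {n : ℕ}
    {A E : ℕ → Matrix X X ℂ}
    (hprim : IsPrimIdem (fun i : Fin (n + 1) => A i) (fun i : Fin (n + 1) => E i))
    (hE : ∀ i ≤ n, ∃ a : ℂ, a ≠ 0 ∧ ∃ R ∈ Submodule.span ℂ (hadamardPow (E 1) '' Set.Iio i),
      E i = a • hadamardPow (E 1) i + R) :
    Submodule.span ℂ (Set.range fun i : Fin (n + 1) => A i)
      ≤ Submodule.span ℂ (hadamardPow (E 1) '' Set.Iio (n + 1)) := by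
  rw [← hprim.span_eq, Submodule.span_le]
  rintro _ ⟨i, rfl⟩
  obtain ⟨a, -, R, hR, h⟩ := hE i (Nat.lt_succ_iff.1 i.2)
  simp only [h]
  refine Submodule.add_mem _ (Submodule.smul_mem _ _ (Submodule.subset_span ⟨i, i.2, rfl⟩)) ?_
  exact Submodule.span_mono (Set.image_mono (Set.Iio_subset_Iio i.2.le)) hR

variable {X Y : Type*} [Fintype X] [DecidableEq X] [Fintype Y] [DecidableEq Y]

omit [Fintype X] [Fintype Y] [DecidableEq Y] in
theorem hpow_compE_left (E : ℕ → Matrix X X ℂ) (E' : ℕ → Matrix Y Y ℂ) {k : ℕ} (hk : 1 ≤ k) :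
    hpow (fun i => compE E E' (epsV i)) ![k, 0] = (1 : Matrix X X ℂ) ⊗ₖ hadamardPow (E' 1) k := by
  ext p q
  by_cases h : p.1 = q.1
  · simp [hpow, epsV_zero, compE, hadamardPow, Matrix.one_apply, h]
  · simp [hpow, epsV_zero, compE, hadamardPow, h, show k ≠ 0 by omega]

omit [Fintype X] [DecidableEq Y] in
theorem hpow_compE_right (E : ℕ → Matrix X X ℂ) {E' : ℕ → Matrix Y Y ℂ}
    (hE'0 : E' 0 = (Fintype.card Y : ℂ)⁻¹ • matJ Y) (k : ℕ) :
    hpow (fun i => compE E E' (epsV i)) ![0, k]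
      = ((Fintype.card Y : ℂ)⁻¹ ^ k) • (hadamardPow (E 1) k ⊗ₖ matJ Y) := by
  ext p q
  simp [hpow, epsV_one, compE, hadamardPow, matJ, hE'0, mul_pow, mul_comm]

omit [Fintype X] [DecidableEq Y] in
theorem hpow_compE_mixed {E : ℕ → Matrix X X ℂ} {E' : ℕ → Matrix Y Y ℂ}
    (hE'0 : E' 0 = (Fintype.card Y : ℂ)⁻¹ • matJ Y) {d : ℂ} (hd : ∀ x, E 1 x x = d)
    {k : ℕ} (hk : 1 ≤ k) (l : ℕ) :
    hpow (fun i => compE E E' (epsV i)) ![k, l]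
      = ((d * (Fintype.card Y : ℂ)⁻¹) ^ l) • hpow (fun i => compE E E' (epsV i)) ![k, 0] := by
  ext p q
  by_cases h : p.1 = q.1
  · simp [hpow, epsV_zero, epsV_one, compE, matJ, hE'0, h, hd, mul_comm]
  · simp [hpow, epsV_zero, compE, h, show k ≠ 0 by omega]

omit [Fintype X] [DecidableEq Y] in
theorem kronecker_matJ_mem_span_hpow [Nonempty Y] {n m : ℕ} {E : ℕ → Matrix X X ℂ}
    {E' : ℕ → Matrix Y Y ℂ} (hE'0 : E' 0 = (Fintype.card Y : ℂ)⁻¹ • matJ Y)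
    {k : ℕ} (hk : k ≤ n + 1) {M : Matrix X X ℂ}
    (hM : M ∈ Submodule.span ℂ (hadamardPow (E 1) '' Set.Iio k)) :
    M ⊗ₖ matJ Y ∈ Submodule.span ℂ (hpow (fun i => compE E E' (epsV i)) ''
      {β | β ∈ compD m n ∧ β 0 = 0 ∧ β 1 < k}) := by
  refine kronecker_mem_of_mem_span hM ?_
  rintro _ ⟨l, hl, rfl⟩
  have hl' : l < k := hl
  have h := hpow_compE_right E hE'0 l
  rw [← inv_smul_eq_iff₀ (by simp)] at h
  rw [← h]
  exact Submodule.smul_mem _ _ (Submodule.subset_span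
    ⟨_, ⟨right_mem_compD (by omega), by simp, by simpa using hl'⟩, rfl⟩)

omit [Fintype X] [DecidableEq Y] in
theorem one_kronecker_mem_span_hpow [Nonempty Y] {n m : ℕ} {E : ℕ → Matrix X X ℂ}
    {E' : ℕ → Matrix Y Y ℂ} (hE'0 : E' 0 = (Fintype.card Y : ℂ)⁻¹ • matJ Y)
    (hone : (1 : Matrix X X ℂ) ∈ Submodule.span ℂ (hadamardPow (E 1) '' Set.Iio (n + 1)))
    {k : ℕ} (h1 : 1 ≤ k) (hk : k ≤ m + 1) {N : Matrix Y Y ℂ}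
    (hN : N ∈ Submodule.span ℂ (hadamardPow (E' 1) '' Set.Iio k)) :
    (1 : Matrix X X ℂ) ⊗ₖ N ∈ Submodule.span ℂ (hpow (fun i => compE E E' (epsV i)) ''
      {β | β ∈ compD m n ∧ β 0 < k}) := by
  refine one_kronecker_mem_of_mem_span hN ?_
  rintro _ ⟨l, hl, rfl⟩
  have hl' : l < k := hl
  rcases Nat.eq_zero_or_pos l with rfl | hl0
  · have hJ : hadamardPow (E' 1) 0 = matJ Y := by
      ext x y
      simp [hadamardPow, matJ]
    rw [hJ]
    refine Submodule.span_mono (Set.image_mono ?_)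
      (kronecker_matJ_mem_span_hpow (m := m) hE'0 le_rfl hone)
    rintro β ⟨hβ, h0, -⟩
    exact ⟨hβ, by omega⟩
  · rw [← hpow_compE_left E E' hl0]
    exact Submodule.subset_span ⟨_, ⟨left_mem_compD hl0 (by omega), by simpa using hl'⟩, rfl⟩

end HadamardPowers

section Main

variable {X Y : Type*} [Fintype X] [DecidableEq X] [Fintype Y] [DecidableEq Y]

omit [DecidableEq Y] in
theorem compE_exists_isMultideg [Nonempty X] [Nonempty Y] {n m : ℕ} {E : ℕ → Matrix X X ℂ}
    {E' : ℕ → Matrix Y Y ℂ} (hE'0 : E' 0 = (Fintype.card Y : ℂ)⁻¹ • matJ Y)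
    (hone : (1 : Matrix X X ℂ) ∈ Submodule.span ℂ (hadamardPow (E 1) '' Set.Iio (n + 1)))
    (hE : ∀ i ≤ n, ∃ a : ℂ, a ≠ 0 ∧ ∃ R ∈ Submodule.span ℂ (hadamardPow (E 1) '' Set.Iio i),
      E i = a • hadamardPow (E 1) i + R)
    (hE' : ∀ j ≤ m, ∃ a : ℂ, a ≠ 0 ∧ ∃ R ∈ Submodule.span ℂ (hadamardPow (E' 1) '' Set.Iio j),
      E' j = a • hadamardPow (E' 1) j + R)
    {mo : MonOrder 2} (hmo : mo.le = fun a b => lexLe a b) :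
    ∀ α ∈ compD m n, ∃ v : MvPolynomial (Fin 2) ℂ,
      (Fintype.card (X × Y) : ℂ) • compE E E' α
          = hEval v (fun i => (Fintype.card (X × Y) : ℂ) • compE E E' (epsV i)) ∧
        IsMultideg mo v α ∧ ∀ d ∈ v.support, ⇑d ∈ compD m n := by
  have hcard : (Fintype.card (X × Y) : ℂ) ≠ 0 := by simp
  have hY : (Fintype.card Y : ℂ) ≠ 0 := by simp
  rw [forall_mem_compD]
  refine ⟨fun j h1 hj => ?_, fun i hi => ?_⟩
  · obtain ⟨a, ha, R, hR, h⟩ := hE' j hj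
    refine exists_isMultideg (R := (1 : Matrix X X ℂ) ⊗ₖ R) hcard (left_mem_compD h1 hj) ha
      (Submodule.span_mono (Set.image_mono ?_)
        (one_kronecker_mem_span_hpow (m := m) hE'0 hone h1 (by omega) hR)) ?_
    · rintro β ⟨hβ, hlt⟩
      refine ⟨hβ, ?_, ?_⟩
      · simp only [hmo, lexLe_fin_two]
        exact .inl (by simpa using hlt)
      · rintro rfl
        simp at hlt
    · rw [compE_left E E' h1, hpow_compE_left E E' h1, h, Matrix.kronecker_add,
        Matrix.kronecker_smul]
  · obtain ⟨a, ha, R, hR, h⟩ := hE i hi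
    refine exists_isMultideg (a := (Fintype.card Y : ℂ)⁻¹ * a * (Fintype.card Y : ℂ) ^ i)
      (R := (Fintype.card Y : ℂ)⁻¹ • (R ⊗ₖ matJ Y)) hcard (right_mem_compD hi)
      (by simp [ha]) (Submodule.smul_mem _ _ (Submodule.span_mono (Set.image_mono ?_)
        (kronecker_matJ_mem_span_hpow (n := n) (m := m) hE'0 (by omega) hR))) ?_
    · rintro β ⟨hβ, h0, hlt⟩
      refine ⟨hβ, ?_, ?_⟩
      · simp only [hmo, lexLe_fin_two]
        exact .inr ⟨by simpa using h0, by simpa using hlt.le⟩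
      · rintro rfl
        simp at hlt
    · rw [compE_right, hpow_compE_right E hE'0, hE'0, h, Matrix.kronecker_smul,
        Matrix.add_kronecker, Matrix.smul_kronecker, smul_add, smul_smul, smul_smul, inv_pow,
        mul_inv_cancel_right₀ (pow_ne_zero i hY)]

theorem hpow_compE_add_epsV_mem [Nonempty Y] {n m : ℕ} {A E : ℕ → Matrix X X ℂ}
    {A' E' : ℕ → Matrix Y Y ℂ} (hn : 1 ≤ n) (hm : 1 ≤ m)
    (hXscheme : IsAssocScheme fun i : Fin (n + 1) => A i)
    (hYscheme : IsAssocScheme fun j : Fin (m + 1) => A' j)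
    (hXprim : IsPrimIdem (fun i : Fin (n + 1) => A i) (fun i : Fin (n + 1) => E i))
    (hYprim : IsPrimIdem (fun j : Fin (m + 1) => A' j) (fun j : Fin (m + 1) => E' j))
    (hE'0 : E' 0 = (Fintype.card Y : ℂ)⁻¹ • matJ Y)
    (hX : Submodule.span ℂ (Set.range fun i : Fin (n + 1) => A i)
      ≤ Submodule.span ℂ (hadamardPow (E 1) '' Set.Iio (n + 1)))
    (hY : Submodule.span ℂ (Set.range fun j : Fin (m + 1) => A' j)
      ≤ Submodule.span ℂ (hadamardPow (E' 1) '' Set.Iio (m + 1)))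
    (i : Fin 2) : ∀ α ∈ compD m n, hpow (fun j => compE E E' (epsV j)) (α + epsV i) ∈
      Submodule.span ℂ (hpow (fun j => compE E E' (epsV j)) ''
        {β | β ∈ compD m n ∧ lexLe β (α + epsV i)}) := by
  have hone : (1 : Matrix X X ℂ) ∈ Submodule.span ℂ (hadamardPow (E 1) '' Set.Iio (n + 1)) := by
    obtain ⟨i₀, h⟩ := hXscheme.exists_id
    exact hX (Submodule.subset_span ⟨i₀, h⟩)
  have hE1 : E 1 ∈ Submodule.span ℂ (Set.range fun i : Fin (n + 1) => A i) := by
    rw [← hXprim.span_eq]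
    exact Submodule.subset_span ⟨⟨1, by omega⟩, rfl⟩
  have hE'1 : E' 1 ∈ Submodule.span ℂ (Set.range fun j : Fin (m + 1) => A' j) := by
    rw [← hYprim.span_eq]
    exact Submodule.subset_span ⟨⟨1, by omega⟩, rfl⟩
  obtain ⟨d, hd⟩ := hXscheme.exists_diag_eq hE1
  have hmixed (γ : Fin 2 → ℕ) (k l : ℕ) (hγ : γ = ![k, l]) (h1 : 1 ≤ k) (hk : k ≤ m) :
      hpow (fun j => compE E E' (epsV j)) γ ∈ Submodule.span ℂ
        (hpow (fun j => compE E E' (epsV j)) '' {β | β ∈ compD m n ∧ lexLe β γ}) := by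
    subst hγ
    rw [hpow_compE_mixed hE'0 hd h1]
    exact Submodule.smul_mem _ _ (Submodule.subset_span
      ⟨_, ⟨left_mem_compD h1 hk, by simp [lexLe_fin_two]⟩, rfl⟩)
  revert i
  rw [Fin.forall_fin_two]
  simp only [forall_mem_compD, epsV_zero, epsV_one]
  refine ⟨⟨fun k h1 hk => ?_, fun k hk => hmixed _ 1 k (by simp) le_rfl hm⟩,
    ⟨fun k h1 hk => hmixed _ k 1 (by simp) h1 hk, fun k hk => ?_⟩⟩
  · rw [show (![k, 0] + ![1, 0] : Fin 2 → ℕ) = ![k + 1, 0] by simp]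
    rcases hk.lt_or_eq with hlt | rfl
    · exact hmixed _ (k + 1) 0 rfl (by omega) hlt
    · rw [hpow_compE_left E E' (by omega)]
      refine Submodule.span_mono (Set.image_mono ?_)
        (one_kronecker_mem_span_hpow (m := k) hE'0 hone (by omega) le_rfl
          (hY (hYscheme.hadamardPow_mem hE'1 (k + 1))))
      rintro β ⟨hβ, hlt⟩
      exact ⟨hβ, lexLe_fin_two.2 (.inl (by simpa using hlt))⟩
  · rw [show (![0, k] + ![0, 1] : Fin 2 → ℕ) = ![0, k + 1] by simp]
    rcases hk.lt_or_eq with hlt | rfl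
    · exact Submodule.subset_span ⟨_, ⟨right_mem_compD hlt, .inl rfl⟩, rfl⟩
    · rw [hpow_compE_right E hE'0]
      refine Submodule.smul_mem _ _ (Submodule.span_mono (Set.image_mono ?_)
        (kronecker_matJ_mem_span_hpow (m := m) hE'0 le_rfl
          (hX (hXscheme.hadamardPow_mem hE1 (k + 1)))))
      rintro β ⟨hβ, h0, hlt⟩
      exact ⟨hβ, lexLe_fin_two.2 (.inr ⟨by simpa using h0, by simpa using hlt.le⟩)⟩

end Main

/-- Theorem 4.2 (ii): the composition of `Q`-polynomial association schemes `𝔛` and `𝔜`, whose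
primitive idempotents are `E_{j0} = I_X ⊗ E'_j` (`1 ≤ j ≤ m`) and `E_{0i} = E_i ⊗ E'_0`
(`0 ≤ i ≤ n`), is a bivariate `Q`-polynomial association scheme on
`D* = {(j,0)}ⱼ₌₁ᵐ ∪ {(0,i)}ᵢ₌₀ⁿ` with respect to the lexicographic order. -/
theorem composition_isMultiQPoly {X Y : Type*} [Fintype X] [DecidableEq X]
    [Fintype Y] [DecidableEq Y] (n m : ℕ) (hn : 1 ≤ n) (hm : 1 ≤ m)
    (A : ℕ → Matrix X X ℂ) (A' : ℕ → Matrix Y Y ℂ)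
    (E : ℕ → Matrix X X ℂ) (E' : ℕ → Matrix Y Y ℂ)
    (hXscheme : IsAssocScheme fun i : Fin (n + 1) => A i)
    (hYscheme : IsAssocScheme fun j : Fin (m + 1) => A' j)
    (hA0 : A 0 = 1) (hA'0 : A' 0 = 1)
    (hXsym : ∀ i ≤ n, (A i)ᵀ = A i) (hYsym : ∀ j ≤ m, (A' j)ᵀ = A' j)
    (hXprim : IsPrimIdem (fun i : Fin (n + 1) => A i) (fun i : Fin (n + 1) => E i))
    (hYprim : IsPrimIdem (fun j : Fin (m + 1) => A' j) (fun j : Fin (m + 1) => E' j))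
    (hE0 : E 0 = (Fintype.card X : ℂ)⁻¹ • matJ X)
    (hE'0 : E' 0 = (Fintype.card Y : ℂ)⁻¹ • matJ Y)
    (hXQ : ∀ i ≤ n, ∃ v : Polynomial ℂ, v.degree = (i : ℕ) ∧
      (Fintype.card X : ℂ) • E i = hEval1 v ((Fintype.card X : ℂ) • E 1))
    (hYQ : ∀ j ≤ m, ∃ v : Polynomial ℂ, v.degree = (j : ℕ) ∧
      (Fintype.card Y : ℂ) • E' j = hEval1 v ((Fintype.card Y : ℂ) • E' 1))
    (mo : MonOrder 2) (hmo : mo.le = fun a b => lexLe a b) :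
    IsMultiQPoly (compD m n) mo
      (fun a : {x // x ∈ compD n m} => compA A A' a.1) (compE E E') := by
  have heps : ∀ i : Fin 2, epsV i ∈ compD m n := by
    rw [Fin.forall_fin_two, epsV_zero, epsV_one]
    exact ⟨left_mem_compD le_rfl hm, right_mem_compD hn⟩
  have hlower : ∀ α ∈ compD m n, ∀ β : Fin 2 → ℕ, (∀ i, β i ≤ α i) → β ∈ compD m n := by
    intro α hα β h
    rw [mem_compD] at hα ⊢
    have h0 := h 0
    have h1 := h 1
    omega
  have hscheme := hXscheme.comp hYscheme hA0 hA'0 hXsym hYsym hYprim hE'0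
  have hprim := hXprim.comp hYprim hYscheme hA0 hE'0
  rcases isEmpty_or_nonempty (X × Y) with hXY | hXY
  · refine ⟨hscheme, hprim, heps, hlower, fun α hα => ?_, fun i α _ => ⟨0, ?_, by simp⟩⟩
    · obtain ⟨v, -, hv⟩ := exists_isMultideg (mo := mo)
        (F := fun i : Fin 2 => compE E E' (epsV i)) (R := 0) one_ne_zero hα one_ne_zero
        (Submodule.zero_mem _) rfl
      exact ⟨v, Subsingleton.elim _ _, hv⟩
    · exact Subsingleton.elim _ _
  · have hXne : Nonempty X := hXY.map Prod.fst
    have hYne : Nonempty Y := hXY.map Prod.snd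
    have hE : ∀ i ≤ n, ∃ a : ℂ, a ≠ 0 ∧
        ∃ R ∈ Submodule.span ℂ (hadamardPow (E 1) '' Set.Iio i),
          E i = a • hadamardPow (E 1) i + R := fun i hi => by
      obtain ⟨v, hv, h⟩ := hXQ i hi
      exact exists_hadamardPow_add (by simp) hv h
    have hE' : ∀ j ≤ m, ∃ a : ℂ, a ≠ 0 ∧
        ∃ R ∈ Submodule.span ℂ (hadamardPow (E' 1) '' Set.Iio j),
          E' j = a • hadamardPow (E' 1) j + R := fun j hj => by
      obtain ⟨v, hv, h⟩ := hYQ j hj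
      exact exists_hadamardPow_add (by simp) hv h
    have hX := span_le_span_hadamardPow hXprim hE
    have hY := span_le_span_hadamardPow hYprim hE'
    have hone : (1 : Matrix X X ℂ) ∈
        Submodule.span ℂ (hadamardPow (E 1) '' Set.Iio (n + 1)) :=
      hX (Submodule.subset_span ⟨0, hA0⟩)
    refine ⟨hscheme, hprim, heps, hlower, compE_exists_isMultideg hE'0 hone hE hE' hmo,
      fun i α hα => ?_⟩
    obtain ⟨c, hc, hle⟩ := exists_sum_of_mem_span_hpow (hpow_compE_add_epsV_mem hn hm hXscheme
      hYscheme hXprim hYprim hE'0 hX hY i α hα)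
    refine ⟨c, ?_, fun β _ hβ => ?_⟩
    · rw [← hc, ← hadamard_hpow]
    · rw [hmo]
      exact (hle β hβ).2
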